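/- Let d be a positive integer and let X, Y be d×d complex matrices. Then ∫_{U(d)} Tr(X U Y Ū) dμ(U) = Tr(X Yᵀ) / d, where Ū denotes the entrywise complex conjugate of U and Yᵀ the transpose of Y. -/

import Mathlib

open MeasureTheory Matrix

noncomputable instance {ι : Type*} [Fintype ι] [DecidableEq ι] :
    MeasurableSpace (Matrix.unitaryGroup ι ℂ) := borel _

instance {ι : Type*} [Fintype ι] [DecidableEq ι] :
    BorelSpace (Matrix.unitaryGroup ι ℂ) := ⟨rfl⟩

theorem aux_int {d : ℕ} (μ : Measure (Matrix.unitaryGroup (Fin d) ℂ))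
    [IsProbabilityMeasure μ] (b c e a : Fin d) :
    Integrable (fun U : Matrix.unitaryGroup (Fin d) ℂ =>
      (U : Matrix (Fin d) (Fin d) ℂ) b c * star ((U : Matrix (Fin d) (Fin d) ℂ) e a)) μ := by
  have hc : Continuous (fun U : Matrix.unitaryGroup (Fin d) ℂ =>
      (U : Matrix (Fin d) (Fin d) ℂ) b c * star ((U : Matrix (Fin d) (Fin d) ℂ) e a)) :=
    (continuous_subtype_val.matrix_elem b c).mul (continuous_subtype_val.matrix_elem e a).star
  refine Integrable.of_bound hc.measurable.aestronglyMeasurable 1 (Filter.Eventually.of_forall ?_)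
  intro U
  rw [norm_mul, norm_star]
  exact mul_le_one₀ (entry_norm_bound_of_unitary U.2 b c) (norm_nonneg _)
    (entry_norm_bound_of_unitary U.2 e a)

theorem aux_inv {d : ℕ} (μ : Measure (Matrix.unitaryGroup (Fin d) ℂ))
    [μ.IsHaarMeasure] (V : Matrix.unitaryGroup (Fin d) ℂ) (b c e a : Fin d) :
    ∫ U : Matrix.unitaryGroup (Fin d) ℂ,
      ((V : Matrix (Fin d) (Fin d) ℂ) * (U : Matrix (Fin d) (Fin d) ℂ)) b c *
        star (((V : Matrix (Fin d) (Fin d) ℂ) * (U : Matrix (Fin d) (Fin d) ℂ)) e a) ∂μ =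
    ∫ U : Matrix.unitaryGroup (Fin d) ℂ,
      (U : Matrix (Fin d) (Fin d) ℂ) b c * star ((U : Matrix (Fin d) (Fin d) ℂ) e a) ∂μ :=
  integral_mul_left_eq_self (μ := μ) (fun U : Matrix.unitaryGroup (Fin d) ℂ =>
      (U : Matrix (Fin d) (Fin d) ℂ) b c * star ((U : Matrix (Fin d) (Fin d) ℂ) e a)) V

theorem aux_off {d : ℕ} (μ : Measure (Matrix.unitaryGroup (Fin d) ℂ))
    [μ.IsHaarMeasure] (b c e a : Fin d) (h : b ≠ e) :
    ∫ U : Matrix.unitaryGroup (Fin d) ℂ,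
      (U : Matrix (Fin d) (Fin d) ℂ) b c * star ((U : Matrix (Fin d) (Fin d) ℂ) e a) ∂μ = 0 := by
  have hV : Matrix.diagonal (fun i : Fin d => if i = b then (-1 : ℂ) else 1) ∈
      Matrix.unitaryGroup (Fin d) ℂ := by
    rw [Matrix.mem_unitaryGroup_iff, star_eq_conjTranspose, diagonal_conjTranspose,
      diagonal_mul_diagonal, ← diagonal_one]
    congr 1
    funext i
    by_cases hi : i = b <;> simp [hi]
  have := aux_inv μ ⟨_, hV⟩ b c e a
  simp only [diagonal_mul, if_pos, if_neg h.symm, one_mul, neg_mul, integral_neg] at this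
  exact self_eq_neg.mp this.symm

theorem aux_diag {d : ℕ} (μ : Measure (Matrix.unitaryGroup (Fin d) ℂ))
    [μ.IsHaarMeasure] (b c e a : Fin d) :
    ∫ U : Matrix.unitaryGroup (Fin d) ℂ,
      (U : Matrix (Fin d) (Fin d) ℂ) b c * star ((U : Matrix (Fin d) (Fin d) ℂ) b a) ∂μ =
    ∫ U : Matrix.unitaryGroup (Fin d) ℂ,
      (U : Matrix (Fin d) (Fin d) ℂ) e c * star ((U : Matrix (Fin d) (Fin d) ℂ) e a) ∂μ := by
  have hV : (Equiv.swap b e).permMatrix ℂ ∈ Matrix.unitaryGroup (Fin d) ℂ := by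
    rw [Matrix.mem_unitaryGroup_iff, star_eq_conjTranspose, Matrix.conjTranspose_permMatrix,
      ← Matrix.permMatrix_mul]
    simp
  have := aux_inv μ ⟨_, hV⟩ b c b a
  simp only [Equiv.Perm.permMatrix, PEquiv.toMatrix_toPEquiv_mul, submatrix_apply, id_eq, Equiv.swap_apply_left] at this
  exact this.symm

theorem aux_val {d : ℕ} (hd : 0 < d) (μ : Measure (Matrix.unitaryGroup (Fin d) ℂ))
    [μ.IsHaarMeasure] [IsProbabilityMeasure μ] (b c e a : Fin d) :
    ∫ U : Matrix.unitaryGroup (Fin d) ℂ,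
      (U : Matrix (Fin d) (Fin d) ℂ) b c * star ((U : Matrix (Fin d) (Fin d) ℂ) e a) ∂μ =
    if b = e ∧ c = a then (d : ℂ)⁻¹ else 0 := by
  by_cases h : b = e
  swap
  · rw [aux_off μ b c e a h]; simp [h]
  subst h
  have h1 : ∑ i : Fin d, ∫ U : Matrix.unitaryGroup (Fin d) ℂ,
      (U : Matrix (Fin d) (Fin d) ℂ) i c * star ((U : Matrix (Fin d) (Fin d) ℂ) i a) ∂μ =
      if c = a then 1 else 0 := by
    rw [← integral_finsetSum _ (fun i _ => aux_int μ i c i a)]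
    have : ∀ U : Matrix.unitaryGroup (Fin d) ℂ, ∑ i : Fin d,
        (U : Matrix (Fin d) (Fin d) ℂ) i c * star ((U : Matrix (Fin d) (Fin d) ℂ) i a) =
        if c = a then 1 else 0 := by
      intro U
      have h2 := congrFun (congrFun (Matrix.mem_unitaryGroup_iff'.mp U.2) a) c
      rw [Matrix.mul_apply, Matrix.one_apply] at h2
      simp only [eq_comm (a := c)]
      rw [← h2]
      refine Finset.sum_congr rfl fun i _ => ?_
      rw [mul_comm]; rfl
    simp only [this]; simp
  rw [Finset.sum_congr rfl (fun i _ => aux_diag μ i c b a)] at h1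
  have hd' : (d : ℂ) ≠ 0 := by exact_mod_cast hd.ne'
  simp only [Finset.sum_const, Finset.card_univ, Fintype.card_fin, nsmul_eq_mul] at h1
  rw [← mul_right_inj' hd', h1]
  by_cases hc : c = a <;> simp [hc, hd']

/-- `∫_{U(d)} Tr(X U Y Ū) dμ(U) = Tr(X Yᵀ) / d`, where `Ū` is the entrywise complex
conjugate of `U`. -/
theorem stmt_13 (d : ℕ) (hd : 0 < d)
    (μ : Measure (Matrix.unitaryGroup (Fin d) ℂ))
    [μ.IsHaarMeasure] [IsProbabilityMeasure μ]
    (X Y : Matrix (Fin d) (Fin d) ℂ) :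
    ∫ U : Matrix.unitaryGroup (Fin d) ℂ,
        (X * (U : Matrix (Fin d) (Fin d) ℂ) * Y *
            ((U : Matrix (Fin d) (Fin d) ℂ).map (starRingEnd ℂ))).trace ∂μ
      = (X * Yᵀ).trace / (d : ℂ) := by
  have hexp : ∀ U : Matrix.unitaryGroup (Fin d) ℂ,
      (X * (U : Matrix (Fin d) (Fin d) ℂ) * Y *
            ((U : Matrix (Fin d) (Fin d) ℂ).map (starRingEnd ℂ))).trace =
      ∑ a, ∑ e, ∑ c, ∑ b, (X a b * Y c e) * ((U : Matrix (Fin d) (Fin d) ℂ) b c *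
        star ((U : Matrix (Fin d) (Fin d) ℂ) e a)) := by
    intro U
    simp only [Matrix.trace, Matrix.diag_apply, Matrix.mul_apply, Matrix.map_apply,
      Finset.sum_mul]
    refine Finset.sum_congr rfl fun a _ => Finset.sum_congr rfl fun e _ =>
      Finset.sum_congr rfl fun c _ => Finset.sum_congr rfl fun b _ => ?_
    rw [starRingEnd_apply]; ring
  have hi : ∀ a e c b, Integrable (fun U : Matrix.unitaryGroup (Fin d) ℂ =>
      (X a b * Y c e) * ((U : Matrix (Fin d) (Fin d) ℂ) b c *
        star ((U : Matrix (Fin d) (Fin d) ℂ) e a))) μ :=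
    fun a e c b => (aux_int μ b c e a).const_mul _
  simp only [hexp]
  rw [integral_finsetSum _ fun a _ => integrable_finsetSum _ fun e _ =>
    integrable_finsetSum _ fun c _ => integrable_finsetSum _ fun b _ => hi a e c b]
  simp only [Matrix.trace, Matrix.diag_apply, Matrix.mul_apply, Matrix.transpose_apply,
    Finset.sum_div]
  refine Finset.sum_congr rfl fun a _ => ?_
  rw [integral_finsetSum _ fun e _ =>
    integrable_finsetSum _ fun c _ => integrable_finsetSum _ fun b _ => hi a e c b]
  refine Finset.sum_congr rfl fun e _ => ?_
  rw [integral_finsetSum _ fun c _ => integrable_finsetSum _ fun b _ => hi a e c b]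
  have : ∀ c, ∫ U : Matrix.unitaryGroup (Fin d) ℂ, ∑ b,
      (X a b * Y c e) * ((U : Matrix (Fin d) (Fin d) ℂ) b c *
        star ((U : Matrix (Fin d) (Fin d) ℂ) e a)) ∂μ =
      if c = a then X a e * Y a e / d else 0 := by
    intro c
    rw [integral_finsetSum _ fun b _ => hi a e c b]
    simp only [integral_const_mul, aux_val hd]
    by_cases hc : c = a
    · subst hc; simp [div_eq_mul_inv]
    · simp [hc]
  simp only [this]; simp
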